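/- arXiv:2502.17349 — 2 statements merged into one kernel-verified Lean document; each statement's English description precedes it below -/
import Mathlib

section
/- (Lemma D.1, Lipschitz bound for the cross-domain likelihood.) Fix N ≥ 1, a set A of unordered pairs {i, j} of distinct indices in {1, …, N} (each bond counted once), a reference configuration R̃ ∈ (ℝ³)^N, and constants Z, σ₁, σ₂ > 0. Define f : (ℝ³)^N → ℝ by f(r) = (1/Z)·exp(−(φ₁(r)/(2σ₁²) + φ₂(r)/σ₂)), where φ₁(r) = ‖R̃ − r‖² and φ₂(r) = Σ_{{i,j}∈A} ‖r_i − r_j‖, with (ℝ³)^N carrying the Euclidean norm ‖r‖² = Σ_i ‖r_i‖². Then for all r, r* ∈ (ℝ³)^N, |f(r) − f(r*)| ≤ L·‖r − r*‖, where L = (1/Z)·(e^{−1/2}/σ₁ + N^{3/2}/σ₂). -/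
/-- The configuration space of `N` atoms in `ℝ³`, equipped with the Euclidean
norm `‖r‖² = Σ i, ‖r i‖²`. -/
abbrev Config (N : ℕ) : Type := PiLp 2 (fun _ : Fin N => EuclideanSpace ℝ (Fin 3))


lemma aux_exp (x y : ℝ) (hx : 0 ≤ x) (hy : 0 ≤ y) :
    |Real.exp (-x) - Real.exp (-y)| ≤ |x - y| := by
  have key : ∀ u v : ℝ, 0 ≤ u → u ≤ v → Real.exp (-u) - Real.exp (-v) ≤ v - u := by
    intro u v hu huv
    have h1 : Real.exp (-v) = Real.exp (-u) * Real.exp (u - v) := by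
      rw [← Real.exp_add]; congr 1; ring
    have h2 := Real.add_one_le_exp (u - v)
    have h3 : Real.exp (-u) ≤ 1 := Real.exp_le_one_iff.mpr (by linarith)
    have h4 := Real.exp_pos (-u)
    rw [h1]
    nlinarith
  rcases le_total x y with h | h
  · have := key x y hx h
    have h5 : Real.exp (-y) ≤ Real.exp (-x) := Real.exp_le_exp.mpr (by linarith)
    rw [abs_of_nonneg (by linarith), abs_of_nonpos (by linarith)]; linarith
  · have := key y x hy h
    have h5 : Real.exp (-x) ≤ Real.exp (-y) := Real.exp_le_exp.mpr (by linarith)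
    rw [abs_of_nonpos (by linarith), abs_of_nonneg (by linarith)]; linarith

lemma aux_gauss1 (x y : ℝ) :
    |Real.exp (-(x ^ 2 / 2)) - Real.exp (-(y ^ 2 / 2))| ≤ Real.exp (-1 / 2) * |x - y| := by
  have hd : ∀ t ∈ (Set.univ : Set ℝ), HasDerivWithinAt (fun t : ℝ => Real.exp (-(t ^ 2 / 2)))
      (Real.exp (-(t ^ 2 / 2)) * (-t)) Set.univ t := by
    intro t _
    have h0 : HasDerivAt (fun t : ℝ => -(t ^ 2 / 2)) (-t) t := by
      have := ((hasDerivAt_pow 2 t).div_const 2).fun_neg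
      exact this.congr_deriv (by norm_num)
    exact h0.exp.hasDerivWithinAt
  have hb : ∀ t ∈ (Set.univ : Set ℝ), ‖Real.exp (-(t ^ 2 / 2)) * (-t)‖ ≤ Real.exp (-1 / 2) := by
    intro t _
    have h1 : Real.exp (-1 / 2) = Real.exp (-(t ^ 2 / 2)) * Real.exp ((t ^ 2 - 1) / 2) := by
      rw [← Real.exp_add]; congr 1; ring
    rw [norm_mul, Real.norm_eq_abs, Real.abs_exp, h1, norm_neg, Real.norm_eq_abs]
    apply mul_le_mul_of_nonneg_left _ (Real.exp_pos _).le
    have h2 := Real.add_one_le_exp ((t ^ 2 - 1) / 2)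
    have h3 := sq_abs t
    nlinarith [sq_nonneg (|t| - 1)]
  have := convex_univ.norm_image_sub_le_of_norm_hasDerivWithin_le hd hb
    (Set.mem_univ y) (Set.mem_univ x)
  simpa [Real.norm_eq_abs] using this

lemma aux_gauss (x y σ : ℝ) (hσ : 0 < σ) :
    |Real.exp (-(x ^ 2 / (2 * σ ^ 2))) - Real.exp (-(y ^ 2 / (2 * σ ^ 2)))|
      ≤ Real.exp (-1 / 2) / σ * |x - y| := by
  have := aux_gauss1 (x / σ) (y / σ)
  have e : ∀ z : ℝ, (z / σ) ^ 2 / 2 = z ^ 2 / (2 * σ ^ 2) := by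
    intro z; field_simp
  rw [e, e, ← sub_div, abs_div, abs_of_pos hσ] at this
  calc _ ≤ _ := this
    _ = _ := by ring

lemma aux_sum (N : ℕ) (A : Finset (Fin N × Fin N)) (hA : ∀ p ∈ A, p.1 < p.2)
    (a : Fin N → ℝ) (ha : ∀ i, 0 ≤ a i) :
    ∑ p ∈ A, (a p.1 + a p.2) ≤ N * ∑ i, a i := by
  classical
  have h1 : ∑ p ∈ A, a p.2 = ∑ p ∈ A.image Prod.swap, a p.1 := by
    rw [Finset.sum_image (fun x _ y _ h => Prod.swap_injective h)]
    rfl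
  have hdis : Disjoint A (A.image Prod.swap) := by
    rw [Finset.disjoint_left]
    intro p hp hp2
    obtain ⟨q, hq, rfl⟩ := Finset.mem_image.mp hp2
    exact lt_asymm (hA q hq) (hA _ hp)
  rw [Finset.sum_add_distrib, h1, ← Finset.sum_union hdis]
  calc _ ≤ ∑ p : Fin N × Fin N, a p.1 :=
        Finset.sum_le_sum_of_subset_of_nonneg (Finset.subset_univ _) (fun p _ _ => ha _)
    _ = _ := by
        rw [Fintype.sum_prod_type]
        simp [Finset.mul_sum]

lemma aux_cs (N : ℕ) (d : Config N) :
    (N : ℝ) * ∑ i, ‖d i‖ ≤ (N : ℝ) ^ ((3 : ℝ) / 2) * ‖d‖ := by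
  have h0 : (0 : ℝ) ≤ N := Nat.cast_nonneg N
  have h1 : (∑ i, ‖d i‖) ^ 2 ≤ N * ‖d‖ ^ 2 := by
    rw [PiLp.norm_sq_eq_of_L2]
    simpa using sq_sum_le_card_mul_sum_sq (s := Finset.univ) (f := fun i => ‖d i‖)
  have h2 : ((N : ℝ) ^ ((3 : ℝ) / 2)) ^ 2 = N ^ 3 := by
    rw [← Real.rpow_natCast, ← Real.rpow_mul h0, ← Real.rpow_natCast]
    norm_num
  apply le_of_sq_le_sq _ (by positivity)
  rw [mul_pow, mul_pow, h2]
  nlinarith [mul_le_mul_of_nonneg_left h1 (sq_nonneg (N : ℝ))]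

lemma aux_phi (N : ℕ) (A : Finset (Fin N × Fin N)) (hA : ∀ p ∈ A, p.1 < p.2)
    (r s : Config N) :
    |∑ p ∈ A, ‖r p.1 - r p.2‖ - ∑ p ∈ A, ‖s p.1 - s p.2‖|
      ≤ (N : ℝ) ^ ((3 : ℝ) / 2) * ‖r - s‖ := by
  refine le_trans ?_ (aux_cs N (r - s))
  refine le_trans ?_ (aux_sum N A hA (fun i => ‖(r - s) i‖) (fun i => norm_nonneg _))
  rw [← Finset.sum_sub_distrib]
  refine (Finset.abs_sum_le_sum_abs _ _).trans (Finset.sum_le_sum fun p _ => ?_)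
  refine (abs_norm_sub_norm_le _ _).trans ?_
  have : r p.1 - r p.2 - (s p.1 - s p.2) = (r - s) p.1 - (r - s) p.2 := by
    simp only [PiLp.sub_apply]; abel
  rw [this]
  exact norm_sub_le _ _

/-- Lemma D.1 (Lipschitz bound for the cross-domain likelihood).  The function
`f r = (1/Z) * exp (-(φ₁ r / (2σ₁²) + φ₂ r / σ₂))`, with
`φ₁ r = ‖R̃ - r‖²` and `φ₂ r = Σ_{{i,j} ∈ A} ‖r i - r j‖` (each unordered bond
`{i,j}`, `i < j`, counted once), is Lipschitz with constant
`L = (1/Z) * (exp (-1/2) / σ₁ + N^(3/2) / σ₂)`. -/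
theorem crossDomainLikelihood_lipschitz (N : ℕ) (hN : 1 ≤ N)
    (A : Finset (Fin N × Fin N)) (hA : ∀ p ∈ A, p.1 < p.2)
    (Rtilde : Config N) (Z σ₁ σ₂ : ℝ) (hZ : 0 < Z) (hσ₁ : 0 < σ₁) (hσ₂ : 0 < σ₂) :
    ∀ r rstar : Config N,
      |(1 / Z) * Real.exp (-(‖Rtilde - r‖ ^ 2 / (2 * σ₁ ^ 2)
            + (∑ p ∈ A, ‖r p.1 - r p.2‖) / σ₂))
        - (1 / Z) * Real.exp (-(‖Rtilde - rstar‖ ^ 2 / (2 * σ₁ ^ 2)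
            + (∑ p ∈ A, ‖rstar p.1 - rstar p.2‖) / σ₂))|
        ≤ (1 / Z) * (Real.exp (-1 / 2) / σ₁ + (N : ℝ) ^ ((3 : ℝ) / 2) / σ₂)
            * ‖r - rstar‖ := by
  intro r s
  have hP : ∀ r : Config N, 0 ≤ (∑ p ∈ A, ‖r p.1 - r p.2‖) / σ₂ := fun r =>
    div_nonneg (Finset.sum_nonneg fun _ _ => norm_nonneg _) hσ₂.le
  have hg := aux_gauss ‖Rtilde - r‖ ‖Rtilde - s‖ σ₁ hσ₁
  have hn : |‖Rtilde - r‖ - ‖Rtilde - s‖| ≤ ‖r - s‖ := by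
    refine (abs_norm_sub_norm_le _ _).trans (le_of_eq ?_)
    rw [sub_sub_sub_cancel_left, norm_sub_rev]
  have hg2 := hg.trans (mul_le_mul_of_nonneg_left hn (by positivity))
  have hh := aux_exp _ _ (hP r) (hP s)
  rw [← sub_div, abs_div, abs_of_pos hσ₂] at hh
  have hh2 := hh.trans (div_le_div_of_nonneg_right (aux_phi N A hA r s) hσ₂.le)
  have hG : Real.exp (-(‖Rtilde - s‖ ^ 2 / (2 * σ₁ ^ 2))) ≤ 1 :=
    Real.exp_le_one_iff.mpr (neg_nonpos.mpr (by positivity))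
  have hH : Real.exp (-((∑ p ∈ A, ‖r p.1 - r p.2‖) / σ₂)) ≤ 1 :=
    Real.exp_le_one_iff.mpr (neg_nonpos.mpr (hP r))
  rw [← mul_sub, abs_mul, abs_of_pos (by positivity : 0 < 1 / Z), mul_assoc]
  apply mul_le_mul_of_nonneg_left _ (by positivity)
  rw [neg_add, neg_add, Real.exp_add, Real.exp_add]
  have hG0 := Real.exp_pos (-(‖Rtilde - s‖ ^ 2 / (2 * σ₁ ^ 2)))
  have hH0 := Real.exp_pos (-((∑ p ∈ A, ‖r p.1 - r p.2‖) / σ₂))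
  generalize Real.exp (-(‖Rtilde - s‖ ^ 2 / (2 * σ₁ ^ 2))) = G' at *
  generalize Real.exp (-((∑ p ∈ A, ‖r p.1 - r p.2‖) / σ₂)) = H at *
  generalize Real.exp (-(‖Rtilde - r‖ ^ 2 / (2 * σ₁ ^ 2))) = G at *
  generalize Real.exp (-((∑ p ∈ A, ‖s p.1 - s p.2‖) / σ₂)) = H' at *
  calc |G * H - G' * H'| = |(G - G') * H + G' * (H - H')| := by congr 1; ring
    _ ≤ |G - G'| * H + G' * |H - H'| := by
        refine (abs_add_le _ _).trans (le_of_eq ?_)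
        rw [abs_mul, abs_mul, abs_of_pos hH0, abs_of_pos hG0]
    _ ≤ |G - G'| * 1 + 1 * |H - H'| := by gcongr
    _ ≤ _ := by rw [add_mul, div_mul_eq_mul_div _ σ₂]; linarith
end

section
/- Let d, n ≥ 1, let A : ℝ^d → ℝ^n be everywhere differentiable with ‖DA(x)‖_op ≤ M for all x ∈ ℝ^d (operator norm of the Fréchet derivative), let y ∈ ℝ^n, and let σ > 0. Define the Gaussian measurement likelihood f : ℝ^d → ℝ by f(x) = (2πσ²)^{−n/2}·exp(−‖y − A(x)‖²/(2σ²)), where ‖·‖ denotes Euclidean norms. Then f is Lipschitz with constant (2πσ²)^{−n/2}·M·e^{−1/2}/σ; that is, for all x, x′ ∈ ℝ^d, |f(x) − f(x′)| ≤ (2πσ²)^{−n/2}·(M·e^{−1/2}/σ)·‖x − x′‖. -/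
theorem gauss_scalar_lip (σ : ℝ) (hσ : 0 < σ) (a b : ℝ) :
    |Real.exp (-a ^ 2 / (2 * σ ^ 2)) - Real.exp (-b ^ 2 / (2 * σ ^ 2))|
      ≤ Real.exp (-1 / 2) / σ * |a - b| := by
  have hder : ∀ r : ℝ, HasDerivAt (fun r : ℝ => Real.exp (-r ^ 2 / (2 * σ ^ 2)))
      (Real.exp (-r ^ 2 / (2 * σ ^ 2)) * (-(2 * r) / (2 * σ ^ 2))) r := by
    intro r
    have h := (((hasDerivAt_pow 2 r).neg).div_const (2 * σ ^ 2)).exp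
    simpa using h
  have hb : ∀ r : ℝ, ‖Real.exp (-r ^ 2 / (2 * σ ^ 2)) * (-(2 * r) / (2 * σ ^ 2))‖
      ≤ Real.exp (-1 / 2) / σ := by
    intro r
    have h1 : |r| / σ ≤ Real.exp (((|r| / σ) ^ 2 - 1) / 2) := by
      have := Real.add_one_le_exp (((|r| / σ) ^ 2 - 1) / 2)
      nlinarith [sq_nonneg (|r| / σ - 1)]
    have h2 : Real.exp (-1 / 2) =
        Real.exp (-r ^ 2 / (2 * σ ^ 2)) * Real.exp (((|r| / σ) ^ 2 - 1) / 2) := by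
      rw [← Real.exp_add]
      congr 1
      rw [div_pow, sq_abs]
      field_simp
      ring
    have h3 : |(-(2 * r) / (2 * σ ^ 2))| = |r| / σ / σ := by
      rw [abs_div, abs_neg, abs_mul, abs_of_pos (show (0 : ℝ) < 2 by norm_num),
        abs_of_pos (show (0 : ℝ) < 2 * σ ^ 2 by positivity)]
      field_simp
    rw [Real.norm_eq_abs, abs_mul, Real.abs_exp, h3, h2, ← mul_div_assoc]
    gcongr
  have := Convex.norm_image_sub_le_of_norm_hasDerivWithin_le (s := Set.univ)
    (fun r _ => (hder r).hasDerivWithinAt) (fun r _ => hb r) convex_univ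
    (Set.mem_univ b) (Set.mem_univ a)
  simpa [Real.norm_eq_abs] using this

/-- Lipschitz bound for the Gaussian measurement likelihood
`f x = (2πσ²)^(-n/2) * exp (-‖y - A x‖² / (2σ²))`, where `A : ℝ^d → ℝ^n` is
everywhere differentiable with `‖DA x‖ ≤ M` (operator norm) for all `x`.  Then
`f` is Lipschitz with constant `(2πσ²)^(-n/2) * M * exp (-1/2) / σ`. -/
theorem gaussian_measurement_likelihood_lipschitz (d n : ℕ) (hd : 1 ≤ d) (hn : 1 ≤ n)
    (A : EuclideanSpace ℝ (Fin d) → EuclideanSpace ℝ (Fin n))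
    (hA : Differentiable ℝ A) (M : ℝ) (hM : ∀ x, ‖fderiv ℝ A x‖ ≤ M)
    (y : EuclideanSpace ℝ (Fin n)) (σ : ℝ) (hσ : 0 < σ) :
    ∀ x x' : EuclideanSpace ℝ (Fin d),
      |(2 * Real.pi * σ ^ 2) ^ (-(n : ℝ) / 2)
            * Real.exp (-‖y - A x‖ ^ 2 / (2 * σ ^ 2))
        - (2 * Real.pi * σ ^ 2) ^ (-(n : ℝ) / 2)
            * Real.exp (-‖y - A x'‖ ^ 2 / (2 * σ ^ 2))|
        ≤ (2 * Real.pi * σ ^ 2) ^ (-(n : ℝ) / 2)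
            * (M * Real.exp (-1 / 2) / σ) * ‖x - x'‖ := by
  intro x x'
  have hL : ‖A x - A x'‖ ≤ M * ‖x - x'‖ :=
    Convex.norm_image_sub_le_of_norm_fderiv_le (s := Set.univ) (fun z _ => hA z)
      (fun z _ => hM z) convex_univ (Set.mem_univ x') (Set.mem_univ x)
  have h1 : |‖y - A x‖ - ‖y - A x'‖| ≤ M * ‖x - x'‖ := by
    refine (abs_norm_sub_norm_le _ _).trans ?_
    rw [sub_sub_sub_cancel_left, norm_sub_rev]
    exact hL
  have hc : 0 ≤ (2 * Real.pi * σ ^ 2) ^ (-(n : ℝ) / 2) := by positivity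
  rw [← mul_sub, abs_mul, abs_of_nonneg hc, mul_assoc _ (M * Real.exp (-1 / 2) / σ)]
  refine mul_le_mul_of_nonneg_left ?_ hc
  refine (gauss_scalar_lip σ hσ _ _).trans ?_
  calc Real.exp (-1 / 2) / σ * |‖y - A x‖ - ‖y - A x'‖|
      ≤ Real.exp (-1 / 2) / σ * (M * ‖x - x'‖) := by gcongr
    _ = _ := by ring
end
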